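/- Fix an orthonormal basis (e_1,…,e_d) of H and set p_n = |e_n⟩⟨e_n|. For all unitary operators U, V on H, D_X((U p_n U*)_{n=1}^d, (V p_n V*)_{n=1}^d) = inf{‖U − V D‖ : D = ∑_{n=1}^d e^{iθ_n}|e_n⟩⟨e_n| for some θ_1,…,θ_d ∈ ℝ}. (This expresses that X(H) is isometrically isomorphic to the quotient U(H)/U(1)^d of the unitary group by the diagonal torus.) -/

import Mathlib

/- STATEMENT 2: With p_n = |e_n⟩⟨e_n| the standard-basis projections,
D_X((U p_n U*), (V p_n V*)) = inf {‖U − V·D‖ : D = ∑ e^{iθ_n}|e_n⟩⟨e_n|},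
i.e. X(H) ≅ U(H)/U(1)^d isometrically. -/

noncomputable section

abbrev E (d : ℕ) : Type := EuclideanSpace ℂ (Fin d)
abbrev Op (d : ℕ) : Type := E d →L[ℂ] E d

/-- The rank-one operator `|x⟩⟨y| : h ↦ ⟨y, h⟩ x`. -/
def rankOne {d : ℕ} (x y : E d) : Op d :=
  (ContinuousLinearMap.toSpanSingleton ℂ x).comp (innerSL ℂ y)

/-- The standard orthonormal basis vector `e_n` of `ℂ^d`. -/
def stdVec (d : ℕ) (n : Fin d) : E d := EuclideanSpace.single n 1

/-- The standard rank-one projection `p_n = |e_n⟩⟨e_n|`. -/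
def stdProj (d : ℕ) (n : Fin d) : Op d := rankOne (stdVec d n) (stdVec d n)

/-- The distance `D_X` on `X(H)`. -/
def DX {d : ℕ} (p q : Fin d → Op d) : ℝ :=
  sInf {r : ℝ | ∃ U : Op d, U ∈ unitary (Op d) ∧
    (∀ n, q n = U * p n * star U) ∧ r = ‖1 - U‖}

theorem rankOne_apply {d : ℕ} (x y h : E d) : rankOne x y h = inner ℂ y h • x := by
  simp [rankOne]

theorem stdProj_apply {d : ℕ} (n : Fin d) (h : E d) : stdProj d n h = h n • stdVec d n := by
  simp [stdProj, rankOne_apply, stdVec, EuclideanSpace.inner_single_left]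

theorem sum_smul_stdProj_apply {d : ℕ} (c : Fin d → ℂ) (h : E d) (m : Fin d) :
    (∑ n, c n • stdProj d n) h m = c m * h m := by
  simp [stdProj_apply, stdVec, Pi.single_apply]

theorem star_stdProj {d : ℕ} (n : Fin d) : star (stdProj d n) = stdProj d n := by
  rw [ContinuousLinearMap.star_eq_adjoint]
  refine ((ContinuousLinearMap.eq_adjoint_iff _ _).2 fun x y => ?_).symm
  simp only [stdProj, rankOne_apply, inner_smul_left, inner_smul_right, inner_conj_symm]
  ring

theorem sum_smul_stdProj_mul {d : ℕ} (a b : Fin d → ℂ) :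
    (∑ n, a n • stdProj d n) * (∑ n, b n • stdProj d n) = ∑ n, (a n * b n) • stdProj d n := by
  ext h m
  simp only [mul_apply_eq_comp, sum_smul_stdProj_apply, mul_assoc]

theorem star_sum_smul_stdProj {d : ℕ} (a : Fin d → ℂ) :
    star (∑ n, a n • stdProj d n) = ∑ n, star (a n) • stdProj d n := by
  rw [ContinuousLinearMap.star_eq_adjoint, map_sum]
  refine Finset.sum_congr rfl fun n _ => ?_
  rw [map_smulₛₗ, ← ContinuousLinearMap.star_eq_adjoint, star_stdProj, starRingEnd_apply]

theorem sum_one_smul_stdProj (d : ℕ) : ∑ n, (1 : ℂ) • stdProj d n = 1 := by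
  ext h m
  rw [sum_smul_stdProj_apply, one_mul, one_apply_eq_self]

theorem sum_smul_stdProj_mem_unitary {d : ℕ} (a : Fin d → ℂ) (ha : ∀ n, ‖a n‖ = 1) :
    ∑ n, a n • stdProj d n ∈ unitary (Op d) := by
  have h (n : Fin d) : star (a n) * a n = 1 := by
    simp [RCLike.conj_mul, ha]
  rw [Unitary.mem_iff, star_sum_smul_stdProj, sum_smul_stdProj_mul, sum_smul_stdProj_mul]
  simp only [mul_comm (a _), h, sum_one_smul_stdProj, and_self]

theorem commute_sum_smul_stdProj {d : ℕ} (a : Fin d → ℂ) (n : Fin d) :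
    Commute (∑ m, a m • stdProj d m) (stdProj d n) := by
  have h : stdProj d n = ∑ m, (if m = n then (1 : ℂ) else 0) • stdProj d m := by
    ext h k
    rw [sum_smul_stdProj_apply, stdProj_apply]
    by_cases hk : k = n <;> simp [stdVec, hk]
  rw [h, Commute, SemiconjBy, sum_smul_stdProj_mul, sum_smul_stdProj_mul]
  simp only [mul_comm]

theorem exists_eq_sum_exp_smul_stdProj {d : ℕ} {D : Op d} (hD : D ∈ unitary (Op d))
    (hc : ∀ n, Commute D (stdProj d n)) :
    ∃ θ : Fin d → ℝ, D = ∑ n, Complex.exp (θ n * Complex.I) • stdProj d n := by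
  have hvec (n : Fin d) : D (stdVec d n) = D (stdVec d n) n • stdVec d n := by
    have h := congrArg (fun A : Op d => A (stdVec d n)) (hc n).eq
    simpa [mul_apply_eq_comp, stdProj_apply, stdVec] using h
  have hnorm (n : Fin d) : ‖D (stdVec d n) n‖ = 1 := by
    have h := ContinuousLinearMap.norm_map_of_mem_unitary hD (stdVec d n)
    rw [hvec, norm_smul] at h
    simpa [stdVec] using h
  refine ⟨fun n => (D (stdVec d n) n).arg, ?_⟩
  have hexp (n : Fin d) : Complex.exp ((D (stdVec d n) n).arg * Complex.I) = D (stdVec d n) n := by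
    simpa [hnorm] using Complex.norm_mul_exp_arg_mul_I (D (stdVec d n) n)
  simp only [hexp]
  calc D = D * ∑ n, (1 : ℂ) • stdProj d n := by rw [sum_one_smul_stdProj, mul_one]
    _ = ∑ n, D * stdProj d n := by simp only [one_smul, Finset.mul_sum]
    _ = _ := by
      refine Finset.sum_congr rfl fun n _ => ContinuousLinearMap.ext fun h => ?_
      rw [mul_apply_eq_comp, stdProj_apply, map_smul, smul_apply,
        stdProj_apply, smul_comm, ← hvec]

/-- For unitaries `U, V`,
`D_X((U p_n U*)_n, (V p_n V*)_n) = inf {‖U − V D‖ : D a diagonal phase unitary}`. -/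
theorem X_eq_unitary_quotient_torus (d : ℕ) (hd : 1 ≤ d) (U V : Op d)
    (hU : U ∈ unitary (Op d)) (hV : V ∈ unitary (Op d)) :
    DX (fun n => U * stdProj d n * star U) (fun n => V * stdProj d n * star V) =
      sInf {r : ℝ | ∃ θ : Fin d → ℝ,
        r = ‖U - V * ∑ n, Complex.exp (θ n * Complex.I) • stdProj d n‖} := by
  obtain ⟨hU₁, hU₂⟩ := Unitary.mem_iff.1 hU
  obtain ⟨hV₁, hV₂⟩ := Unitary.mem_iff.1 hV
  have hnorm (D : Op d) : ‖1 - V * D * star U‖ = ‖U - V * D‖ := by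
    rw [← CStarRing.norm_mul_mem_unitary _ hU, sub_mul, one_mul, mul_assoc, hU₁, mul_one]
  unfold DX
  congr 1
  ext r
  constructor
  · rintro ⟨W, hW, hWp, rfl⟩
    obtain ⟨hW₁, hW₂⟩ := Unitary.mem_iff.1 hW
    have hD : star V * W * U ∈ unitary (Op d) := mul_mem (mul_mem (Unitary.star_mem hV) hW) hU
    have hVD : V * (star V * W * U) = W * U := by
      rw [← mul_assoc, ← mul_assoc, hV₂, one_mul]
    have hc (n : Fin d) : Commute (star V * W * U) (stdProj d n) := by
      calc star V * W * U * stdProj d n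
          = star V * (W * (U * stdProj d n * star U) * star W) * W * U := by
            simp only [mul_assoc]
            rw [← mul_assoc (star W), hW₁, one_mul, hU₁, mul_one]
        _ = star V * (V * stdProj d n * star V) * W * U := by rw [← hWp]
        _ = stdProj d n * (star V * W * U) := by
            simp only [mul_assoc]
            rw [← mul_assoc (star V), hV₁, one_mul]
    obtain ⟨θ, hθ⟩ := exists_eq_sum_exp_smul_stdProj hD hc
    refine ⟨θ, ?_⟩
    rw [← hθ, ← hnorm, hVD, mul_assoc, hU₂, mul_one]
  · rintro ⟨θ, rfl⟩
    have hD := sum_smul_stdProj_mem_unitary (fun n => Complex.exp (θ n * Complex.I))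
      fun n => Complex.norm_exp_ofReal_mul_I (θ n)
    have hc := commute_sum_smul_stdProj (fun n => Complex.exp (θ n * Complex.I))
    set D : Op d := ∑ n, Complex.exp (θ n * Complex.I) • stdProj d n
    refine ⟨V * D * star U, mul_mem (mul_mem hV hD) (Unitary.star_mem hU), fun n => ?_,
      (hnorm D).symm⟩
    calc V * stdProj d n * star V
        = V * (stdProj d n * D) * star D * star V := by
          simp only [mul_assoc]
          rw [← mul_assoc D, (Unitary.mem_iff.1 hD).2, one_mul]
      _ = V * D * stdProj d n * star D * star V := by rw [← (hc n).eq, mul_assoc V D]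
      _ = V * D * star U * (U * stdProj d n * star U) * star (V * D * star U) := by
          simp only [star_mul, star_star, mul_assoc]
          rw [← mul_assoc (star U) U, hU₁, one_mul, ← mul_assoc (star U) U, hU₁, one_mul]
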